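/- arXiv:1702.01136 — 2 statements merged into one kernel-verified Lean document; each statement's English description precedes it below -/
import Mathlib

section
/- Given a k-terminal DAG G with terminal set K and a pair-set P ⊆ K×K, there exists a reachability-preserving minor H of G with respect to P of size at most |P|·(|P|−1)/2 non-terminal vertices. -/
/-- Reachability in a digraph given by its edge relation: `v` is reachable from `u`
if there is a (possibly empty) directed path from `u` to `v`. -/
def Reach {V : Type*} (E : V → V → Prop) : V → V → Prop := Relation.ReflTransGen E

/-- A set of vertices `S` induces a subgraph of the digraph `E` that is connected in
the underlying undirected graph. -/
def ConnIn {V : Type*} (E : V → V → Prop) (S : Set V) : Prop :=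
  ∀ u ∈ S, ∀ v ∈ S,
    Relation.ReflTransGen (fun a b => a ∈ S ∧ b ∈ S ∧ (E a b ∨ E b a)) u v

/-- `H`, the digraph with vertex set `VH` and edge relation `F`, is a
reachability-preserving minor of the digraph `G` given by the edge relation `E` on `V`
with terminal set `K`, with respect to the pair-set `P`:  `H` has no self-loops, its
edges join vertices of `VH`, `K ⊆ VH`, there are branch sets `φ` witnessing that `H`
is a minor of `G` (nonempty, pairwise disjoint, connected in the underlying undirected
graph, edges of `H` come from edges of `G` between branch sets, and `x ∈ φ x` for each
terminal `x`), and for every pair `(x, x') ∈ P`, `x'` is reachable from `x` in `H` iff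
`x'` is reachable from `x` in `G`. -/
def IsRPMinor {V : Type*} [DecidableEq V] (E : V → V → Prop) (K : Finset V)
    (P : Set (V × V)) (VH : Finset V) (F : V → V → Prop) : Prop :=
  (∀ v, ¬F v v) ∧
  (∀ a b, F a b → a ∈ VH ∧ b ∈ VH) ∧
  (∀ x ∈ K, x ∈ VH) ∧
  (∃ φ : V → Set V,
    (∀ a ∈ VH, (φ a).Nonempty) ∧
    (∀ a ∈ VH, ∀ b ∈ VH, a ≠ b → Disjoint (φ a) (φ b)) ∧
    (∀ a ∈ VH, ConnIn E (φ a)) ∧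
    (∀ a b, F a b → ∃ u ∈ φ a, ∃ v ∈ φ b, E u v) ∧
    (∀ x ∈ K, x ∈ φ x)) ∧
  (∀ p ∈ P, (Reach F p.1 p.2 ↔ Reach E p.1 p.2))

/-- Delete the edge `(u,v)`. -/
def DelE {V : Type*} (F : V → V → Prop) (u v : V) : V → V → Prop :=
  fun a b => F a b ∧ ¬(a = u ∧ b = v)

/-- The edge `(u,v)` is essential for the pair `p`. -/
def Owns {V : Type*} (F : V → V → Prop) (p : V × V) (u v : V) : Prop :=
  F u v ∧ Reach F p.1 p.2 ∧ ¬ Reach (DelE F u v) p.1 p.2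

/-- `v` has two distinct in-edges owned by `p` and `q`. -/
def GoodV {V : Type*} (F : V → V → Prop) (v : V) (p q : V × V) : Prop :=
  ∃ u₁ u₂, u₁ ≠ u₂ ∧ Owns F p u₁ v ∧ Owns F q u₂ v

/-- `v` is contracted into `a`. -/
inductive RootOf {V : Type*} (F : V → V → Prop) (S : Finset V) (a : V) : V → Prop
  | base : a ∈ S → RootOf F S a a
  | step {u v : V} : RootOf F S a u → F u v → v ∉ S → RootOf F S a v

theorem reach_avoid {V : Type*} {F : V → V → Prop} (u v : V) {a b : V} (h : Reach F a b) :
    Reach (DelE F u v) a b ∨ (Reach F a u ∧ Reach F v b) := by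
  unfold Reach at *
  induction h with
  | refl => exact Or.inl .refl
  | @tail b c hab hbc ih =>
    by_cases hc : b = u ∧ c = v
    · obtain ⟨rfl, rfl⟩ := hc
      exact Or.inr ⟨hab, .refl⟩
    · rcases ih with h | ⟨h1, h2⟩
      · exact Or.inl (h.tail ⟨hbc, hc⟩)
      · exact Or.inr ⟨h1, h2.tail hbc⟩

theorem Owns.parts {V : Type*} {F : V → V → Prop} {p : V × V} {u v : V} (h : Owns F p u v) :
    Reach F p.1 u ∧ Reach F v p.2 :=
  (reach_avoid u v h.2.1).resolve_left h.2.2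

theorem Owns.order {V : Type*} {F : V → V → Prop} {p : V × V} {u v u' v' : V}
    (h : Owns F p u v) (h' : Owns F p u' v') (hne : ¬(u = u' ∧ v = v')) :
    Reach F v u' ∨ Reach F v' u := by
  obtain ⟨h1, h2⟩ := h.parts
  rcases reach_avoid u' v' h1 with a | a
  · rcases reach_avoid u' v' h2 with b | b
    · exact absurd ((Relation.ReflTransGen.tail a ⟨h.1, hne⟩).trans b) h'.2.2
    · exact Or.inl b.1
  · exact Or.inr a.2

theorem key_false {V : Type*} {F : V → V → Prop}
    (hac : ∀ v w, F w v → Reach F v w → False) {q : V × V} {v v' u₁' u₂ u₂' : V}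
    (hv : v ≠ v') (hu : u₁' ≠ u₂') (hF : F u₁' v') (hq : Owns F q u₂ v)
    (hq' : Owns F q u₂' v') (hr : Reach F v u₁') : False := by
  have hvv : Reach F v v' := Relation.ReflTransGen.tail hr hF
  apply hq'.2.2
  have s1 : Reach (DelE F u₂' v') q.1 u₂ :=
    (reach_avoid u₂' v' hq.parts.1).resolve_right
      fun h => hac _ _ hq.1 (Relation.ReflTransGen.trans hvv h.2)
  have s2 : Reach (DelE F u₂' v') v u₁' :=
    (reach_avoid u₂' v' hr).resolve_right fun h => hac _ _ hF h.2
  have s3 : Reach (DelE F u₂' v') v' q.2 :=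
    (reach_avoid u₂' v' hq'.parts.2).resolve_right fun h => hac _ _ hq'.1 h.1
  have t1 : Reach (DelE F u₂' v') q.1 v :=
    Relation.ReflTransGen.tail s1 ⟨hq.1, fun h => hv h.2⟩
  have t2 : Reach (DelE F u₂' v') v v' :=
    Relation.ReflTransGen.tail s2 ⟨hF, fun h => hu h.1⟩
  exact (Relation.ReflTransGen.trans t1 t2).trans s3

theorem GoodV.inj {V : Type*} {F : V → V → Prop}
    (hac : ∀ v w, F w v → Reach F v w → False) {p q : V × V} {v v' : V}
    (h : GoodV F v p q) (h' : GoodV F v' p q) : v = v' := by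
  by_contra hv
  obtain ⟨u₁, u₂, hu, hp, hq⟩ := h
  obtain ⟨u₁', u₂', hu', hp', hq'⟩ := h'
  rcases hp.order hp' (fun h => hv h.2) with h | h
  · exact key_false hac hv hu' hp'.1 hq hq' h
  · exact key_false hac (Ne.symm hv) hu hp.1 hq' hq h

theorem GoodV.symm' {V : Type*} {F : V → V → Prop} {p q : V × V} {v : V}
    (h : GoodV F v p q) : GoodV F v q p := by
  obtain ⟨u₁, u₂, hu, hp, hq⟩ := h
  exact ⟨u₂, u₁, hu.symm, hq, hp⟩

theorem GoodV.ne {V : Type*} {F : V → V → Prop}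
    (hac : ∀ v w, F w v → Reach F v w → False) {p q : V × V} {v : V}
    (h : GoodV F v p q) : p ≠ q := by
  rintro rfl
  obtain ⟨u₁, u₂, hu, hp, hq⟩ := h
  rcases hp.order hq (fun h => hu h.1) with h | h
  · exact hac _ _ hq.1 h
  · exact hac _ _ hp.1 h

theorem RootOf.mem {V : Type*} {F : V → V → Prop} {S : Finset V} {a v : V}
    (h : RootOf F S a v) : a ∈ S := by
  induction h with
  | base h => exact h
  | step _ _ _ ih => exact ih

theorem RootOf.reach {V : Type*} {F : V → V → Prop} {S : Finset V} {a v : V}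
    (h : RootOf F S a v) : Reach F a v := by
  induction h with
  | base h => exact Relation.ReflTransGen.refl
  | step _ h _ ih => exact Relation.ReflTransGen.tail ih h

theorem RootOf.eq_of_mem {V : Type*} {F : V → V → Prop} {S : Finset V} {a v : V}
    (h : RootOf F S a v) (hv : v ∈ S) : a = v := by
  cases h with
  | base h => rfl
  | step _ _ h => exact absurd hv h

theorem RootOf.unique {V : Type*} {F : V → V → Prop} {S : Finset V}
    (hS : ∀ v, v ∉ S → ∀ u u', F u v → F u' v → u = u') {a b v : V}
    (h : RootOf F S a v) (h' : RootOf F S b v) : a = b := by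
  induction h with
  | base h => exact (h'.eq_of_mem h).symm
  | @step u v hu hF hv ih =>
    cases h' with
    | base h => exact absurd h hv
    | @step u' _ hu' hF' _ =>
      obtain rfl := hS v hv _ _ hF hF'
      exact ih hu'

theorem RootOf.conn {V : Type*} {E F : V → V → Prop} {S : Finset V}
    (hFE : ∀ a b, F a b → E a b) (a : V) : ConnIn E {v | RootOf F S a v} := by
  have key : ∀ v, RootOf F S a v →
      Relation.ReflTransGen (fun x y => x ∈ {v | RootOf F S a v} ∧ y ∈ {v | RootOf F S a v} ∧
        (E x y ∨ E y x)) a v := by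
    intro v h
    induction h with
    | base h => exact .refl
    | step hu hF hv ih => exact ih.tail ⟨hu, RootOf.step hu hF hv, Or.inl (hFE _ _ hF)⟩
  intro u hu v hv
  refine Relation.ReflTransGen.trans ?_ (key v hv)
  have hk := key u hu
  clear hu hv
  induction hk with
  | refl => exact .refl
  | tail _ h ih => exact Relation.ReflTransGen.head ⟨h.2.1, h.1, h.2.2.symm⟩ ih

/-- Every `k`-terminal DAG `G` (a digraph with no directed cycle) with a pair-set
`P ⊆ K × K` admits a reachability-preserving minor with respect to `P` with at most
`|P|·(|P|−1)/2` non-terminal vertices. -/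
theorem rpm_dag_pairset {V : Type*} [Fintype V] [DecidableEq V]
    (E : V → V → Prop) (hE : ∀ v, ¬E v v)
    (hDAG : ∀ v, ¬Relation.TransGen E v v)
    (K : Finset V) (k : ℕ) (hk : K.card = k)
    (P : Finset (V × V)) (hP : ∀ p ∈ P, p.1 ∈ K ∧ p.2 ∈ K) :
    ∃ (VH : Finset V) (F : V → V → Prop),
      IsRPMinor E K (↑P : Set (V × V)) VH F ∧
      (VH \ K).card ≤ P.card * (P.card - 1) / 2 := by
  classical
  obtain ⟨F, hFmin⟩ := Set.Finite.exists_minimal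
    (s := {F : V → V → Prop | (∀ a b, F a b → E a b) ∧
      ∀ p ∈ P, Reach E p.1 p.2 → Reach F p.1 p.2}) (Set.toFinite _)
    ⟨E, fun _ _ h => h, fun _ _ h => h⟩
  obtain ⟨hFE, hFP⟩ := hFmin.1
  have hreach : ∀ {a b}, Reach F a b → Reach E a b :=
    fun h => Relation.ReflTransGen.mono hFE _ _ h
  have hac : ∀ v w, F w v → Reach F v w → False := fun v w h h' =>
    hDAG v (Relation.TransGen.tail' (hreach h') (hFE _ _ h))
  have howns : ∀ u v, F u v → ∃ p ∈ P, Owns F p u v := by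
    intro u v huv
    by_contra hcon
    push Not at hcon
    have hmem : DelE F u v ∈ {F : V → V → Prop | (∀ a b, F a b → E a b) ∧
        ∀ p ∈ P, Reach E p.1 p.2 → Reach F p.1 p.2} := by
      refine ⟨fun a b h => hFE _ _ h.1, fun p hp h => ?_⟩
      by_contra hn
      exact hcon p hp ⟨huv, hFP p hp h, hn⟩
    have := hFmin.2 hmem (fun a b h => h.1) u v huv
    exact this.2 ⟨rfl, rfl⟩
  let B : Finset V := Finset.univ.filter fun v => ∃ u₁ u₂, u₁ ≠ u₂ ∧ F u₁ v ∧ F u₂ v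
  let S : Finset V := K ∪ B
  have hS : ∀ v, v ∉ S → ∀ u u', F u v → F u' v → u = u' := by
    intro v hv u u' h h'
    by_contra hne
    exact hv (Finset.mem_union_right _ (Finset.mem_filter.2
      ⟨Finset.mem_univ _, u, u', hne, h, h'⟩))
  have hKS : ∀ x ∈ K, x ∈ S := fun x hx => Finset.mem_union_left _ hx
  let H : V → V → Prop := fun a b => b ∈ S ∧ ∃ u, RootOf F S a u ∧ F u b
  refine ⟨S, H, ⟨?_, ?_, hKS, ⟨fun a => {v | RootOf F S a v}, ?_, ?_, ?_, ?_, ?_⟩, ?_⟩, ?_⟩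
  · rintro v ⟨_, u, hu, hF⟩
    exact hac _ _ hF hu.reach
  · rintro a b ⟨hb, u, hu, hF⟩
    exact ⟨hu.mem, hb⟩
  · exact fun a ha => ⟨a, .base ha⟩
  · intro a _ b _ hab
    rw [Set.disjoint_left]
    exact fun v h h' => hab (RootOf.unique hS h h')
  · exact fun a _ => RootOf.conn hFE a
  · rintro a b ⟨hb, u, hu, hF⟩
    exact ⟨u, hu, b, .base hb, hFE _ _ hF⟩
  · exact fun x hx => .base (hKS x hx)
  · intro p hp
    have hp : p ∈ P := hp
    constructor
    · intro h
      apply hreach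
      unfold Reach at h
      generalize p.2 = y at h
      induction h with
      | refl => exact Relation.ReflTransGen.refl
      | tail _ h ih =>
        obtain ⟨_, u, hu, hF⟩ := h
        exact Relation.ReflTransGen.trans ih (Relation.ReflTransGen.tail hu.reach hF)
    · intro h
      have h1 := hFP p hp h
      have gen : ∀ y, Reach F p.1 y → ∃ a, RootOf F S a y ∧ Reach H p.1 a := by
        intro y hy
        unfold Reach at hy
        induction hy with
        | refl => exact ⟨p.1, .base (hKS _ (hP p hp).1), Relation.ReflTransGen.refl⟩
        | @tail y z _ hyz ih =>
          obtain ⟨a, ha, har⟩ := ih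
          by_cases hz : z ∈ S
          · exact ⟨z, .base hz, Relation.ReflTransGen.tail har ⟨hz, y, ha, hyz⟩⟩
          · exact ⟨a, .step ha hyz hz, har⟩
      obtain ⟨a, ha, har⟩ := gen _ h1
      rwa [ha.eq_of_mem (hKS _ (hP p hp).2)] at har
  · have hB : ∀ v ∈ B, ∃ pq : (V × V) × (V × V), pq.1 ∈ P ∧ pq.2 ∈ P ∧ GoodV F v pq.1 pq.2 := by
      intro v hv
      obtain ⟨u₁, u₂, hu, h1, h2⟩ := (Finset.mem_filter.1 hv).2
      obtain ⟨p, hp, hp'⟩ := howns _ _ h1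
      obtain ⟨q, hq, hq'⟩ := howns _ _ h2
      exact ⟨(p, q), hp, hq, u₁, u₂, hu, hp', hq'⟩
    choose! f hf1 hf2 hf3 using hB
    have hsub : S \ K ⊆ B := by
      intro v hv
      rw [Finset.mem_sdiff, Finset.mem_union] at hv
      exact hv.1.resolve_left hv.2
    refine (Finset.card_le_card hsub).trans ?_
    rw [← Nat.choose_two_right, ← Finset.card_powersetCard]
    apply Finset.card_le_card_of_injOn (fun v => {(f v).1, (f v).2})
    · intro v hv
      have hv : v ∈ B := hv
      rw [Finset.mem_coe, Finset.mem_powersetCard]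
      refine ⟨?_, Finset.card_pair ((hf3 v hv).ne hac)⟩
      intro x hx
      rw [Finset.mem_insert, Finset.mem_singleton] at hx
      rcases hx with rfl | rfl
      · exact hf1 v hv
      · exact hf2 v hv
    · intro v hv w hw hvw
      have hv : v ∈ B := hv
      have hw : w ∈ B := hw
      have h2 : ({(f v).1, (f v).2} : Set (V × V)) = {(f w).1, (f w).2} := by
        have := congrArg (fun s : Finset (V × V) => (s : Set (V × V))) hvw
        simpa using this
      have h3 := hf3 v hv
      rcases Set.pair_eq_pair_iff.1 h2 with ⟨e1, e2⟩ | ⟨e1, e2⟩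
      · rw [e1, e2] at h3
        exact h3.inj hac (hf3 w hw)
      · rw [e1, e2] at h3
        exact h3.symm'.inj hac (hf3 w hw)
end

section
/- (Wye-Delta transformation preserves terminal minimum cuts.) Let G be a k-terminal weighted graph and let x ∉ K be a non-terminal whose only incident edges go to three pairwise non-adjacent vertices u, v, w, and suppose c(u,x)+c(v,x) ≥ c(w,x), c(v,x)+c(w,x) ≥ c(u,x), and c(u,x)+c(w,x) ≥ c(v,x). Let G' be obtained from G by deleting x (and its three incident edges) and adding edges {u,v}, {v,w}, {w,u} with capacities (c(u,x)+c(v,x)−c(w,x))/2, (c(v,x)+c(w,x)−c(u,x))/2, and (c(u,x)+c(w,x)−c(v,x))/2, respectively. Then mincut_{G'}(S) = mincut_G(S) for every S ⊆ K. -/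
/-- A `k`-terminal weighted graph: a finite simple undirected graph with nonnegative
edge capacities `c` (with `c u v = 0` whenever `{u,v}` is not an edge). -/
structure WGraph (V : Type*) where
  verts : Finset V
  Adj : V → V → Prop
  symm : ∀ u v, Adj u v → Adj v u
  irrefl : ∀ v, ¬Adj v v
  adj_mem : ∀ u v, Adj u v → u ∈ verts ∧ v ∈ verts
  c : V → V → ℝ
  c_symm : ∀ u v, c u v = c v u
  c_nonneg : ∀ u v, 0 ≤ c u v
  c_support : ∀ u v, ¬Adj u v → c u v = 0

/-- The cost of the cut `(U, verts \ U)`: the sum of the capacities of the edges with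
exactly one endpoint in `U`. -/
noncomputable def cutCost {V : Type*} [DecidableEq V] (G : WGraph V) (U : Finset V) : ℝ :=
  ∑ u ∈ U, ∑ v ∈ G.verts \ U, G.c u v

/-- `mincut G K S` is the minimum cost of an `S`-separating cut, i.e. of a vertex set
`U ⊆ verts` with `U ∩ K = S`. -/
noncomputable def mincut {V : Type*} [DecidableEq V] (G : WGraph V) (K S : Finset V) : ℝ :=
  sInf {x | ∃ U : Finset V, U ⊆ G.verts ∧ U ∩ K = S ∧ x = cutCost G U}

theorem cutCost_nonneg' {V : Type*} [DecidableEq V] (G : WGraph V) (U : Finset V) :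
    0 ≤ cutCost G U :=
  Finset.sum_nonneg fun _ _ => Finset.sum_nonneg fun _ _ => G.c_nonneg _ _

theorem mincut_le' {V : Type*} [DecidableEq V] (G : WGraph V) (K S U : Finset V)
    (hU : U ⊆ G.verts) (hUK : U ∩ K = S) : mincut G K S ≤ cutCost G U := by
  refine csInf_le ⟨0, ?_⟩ ⟨U, hU, hUK, rfl⟩
  rintro _ ⟨U, -, -, rfl⟩
  exact cutCost_nonneg' G U

theorem sum_single_pair' {V : Type*} [DecidableEq V] (A B : Finset V) (p q : V) (r : ℝ) :
    ∑ a ∈ A, ∑ b ∈ B, (if a = p ∧ b = q then r else 0) = if p ∈ A ∧ q ∈ B then r else 0 := by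
  have : ∀ a ∈ A, ∑ b ∈ B, (if a = p ∧ b = q then r else 0) =
      if a = p then (if q ∈ B then r else 0) else 0 := by
    intro a _
    by_cases h : a = p <;> simp [h]
  rw [Finset.sum_congr rfl this]
  by_cases h : p ∈ A <;> simp [h]

set_option linter.unusedSimpArgs false
set_option maxHeartbeats 1000000

/-- The Wye-Delta transformation preserves terminal minimum cuts: if `x ∉ K` is a
non-terminal whose only incident edges go to the three pairwise non-adjacent vertices
`u, v, w`, the three capacities `c u x, c v x, c w x` satisfy the triangle
inequalities, and `G'` is obtained from `G` by deleting `x` (and its three incident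
edges) and adding edges `{u,v}, {v,w}, {w,u}` with capacities
`(c u x + c v x − c w x)/2`, `(c v x + c w x − c u x)/2`, `(c u x + c w x − c v x)/2`,
then `mincut G' K S = mincut G K S` for every `S ⊆ K`. -/
theorem wye_delta_preserves_mincuts {V : Type*} [DecidableEq V]
    (G G' : WGraph V) (K : Finset V) (hK : K ⊆ G.verts)
    (x u v w : V) (hxK : x ∉ K)
    (huv : u ≠ v) (hvw : v ≠ w) (huw : u ≠ w)
    (huvAdj : ¬G.Adj u v) (hvwAdj : ¬G.Adj v w) (huwAdj : ¬G.Adj u w)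
    (hnb : ∀ a, G.Adj x a ↔ a = u ∨ a = v ∨ a = w)
    (h1 : G.c w x ≤ G.c u x + G.c v x)
    (h2 : G.c u x ≤ G.c v x + G.c w x)
    (h3 : G.c v x ≤ G.c u x + G.c w x)
    (hverts : G'.verts = G.verts.erase x)
    (hAdj : ∀ a b, G'.Adj a b ↔
      ((G.Adj a b ∧ a ≠ x ∧ b ≠ x) ∨ ({a, b} : Set V) = {u, v} ∨
        ({a, b} : Set V) = {v, w} ∨ ({a, b} : Set V) = {w, u}))
    (hcuv : G'.c u v = (G.c u x + G.c v x - G.c w x) / 2)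
    (hcvw : G'.c v w = (G.c v x + G.c w x - G.c u x) / 2)
    (hcwu : G'.c w u = (G.c u x + G.c w x - G.c v x) / 2)
    (hcold : ∀ a b, a ≠ x → b ≠ x → ({a, b} : Set V) ≠ {u, v} →
      ({a, b} : Set V) ≠ {v, w} → ({a, b} : Set V) ≠ {w, u} →
      G'.c a b = G.c a b) :
    ∀ S ⊆ K, mincut G' K S = mincut G K S := by
  have hxu : x ≠ u := fun h => G.irrefl x ((hnb x).2 (Or.inl h))
  have hxv : x ≠ v := fun h => G.irrefl x ((hnb x).2 (Or.inr (Or.inl h)))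
  have hxw : x ≠ w := fun h => G.irrefl x ((hnb x).2 (Or.inr (Or.inr h)))
  have hux : G.Adj x u := (hnb u).2 (by simp)
  have hxm := (G.adj_mem _ _ hux).1
  have hum := (G.adj_mem _ _ hux).2
  have hvm := (G.adj_mem _ _ ((hnb v).2 (by simp))).2
  have hwm := (G.adj_mem _ _ ((hnb w).2 (by simp))).2
  -- capacities at `x`
  have hcx : ∀ a, G.c a x = (if a = u then G.c u x else 0) + (if a = v then G.c v x else 0)
      + (if a = w then G.c w x else 0) := by
    intro a
    by_cases hau : a = u
    · subst hau; simp [huv, huw]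
    by_cases hav : a = v
    · subst hav; simp [hvw, hau]
    by_cases haw : a = w
    · subst haw; simp [hau, hav]
    simp only [hau, hav, haw, if_false, add_zero]
    rw [G.c_symm]
    exact G.c_support _ _ (fun h => by have := (hnb a).1 h; tauto)
  have hsx : ∀ A : Finset V, ∑ a ∈ A, G.c a x = (if u ∈ A then G.c u x else 0) +
      (if v ∈ A then G.c v x else 0) + (if w ∈ A then G.c w x else 0) := by
    intro A
    rw [Finset.sum_congr rfl (fun a _ => hcx a)]
    simp [Finset.sum_add_distrib]
  have e1 := G.c_support _ _ huvAdj
  have e2 := G.c_support _ _ hvwAdj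
  have e3 := G.c_support _ _ huwAdj
  have e1' := (G.c_symm v u).trans e1
  have e2' := (G.c_symm w v).trans e2
  have e3' := (G.c_symm w u).trans e3
  have d1 := G'.c_symm u v
  have d2 := G'.c_symm v w
  have d3 := G'.c_symm w u
  have hc' : ∀ a b, a ≠ x → b ≠ x → G'.c a b = G.c a b
      + (if a = u ∧ b = v then G'.c u v else 0) + (if a = v ∧ b = u then G'.c u v else 0)
      + (if a = v ∧ b = w then G'.c v w else 0) + (if a = w ∧ b = v then G'.c v w else 0)
      + (if a = w ∧ b = u then G'.c w u else 0) + (if a = u ∧ b = w then G'.c w u else 0) := by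
    intro a b ha hb
    by_cases k1 : a = u ∧ b = v
    · obtain ⟨rfl, rfl⟩ := k1; simp only [e1]; simp [huv, huv.symm, hvw, hvw.symm, huw, huw.symm]
    by_cases k2 : a = v ∧ b = u
    · obtain ⟨rfl, rfl⟩ := k2; simp only [← d1, e1']; simp [huv, huv.symm, hvw, huw]
    by_cases k3 : a = v ∧ b = w
    · obtain ⟨rfl, rfl⟩ := k3; simp only [e2]; simp [huv, huv.symm, hvw, hvw.symm, huw, huw.symm]
    by_cases k4 : a = w ∧ b = v
    · obtain ⟨rfl, rfl⟩ := k4; simp only [← d2, e2']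
      simp [huv, huv.symm, hvw, hvw.symm, huw, huw.symm]
    by_cases k5 : a = w ∧ b = u
    · obtain ⟨rfl, rfl⟩ := k5; simp only [e3']; simp [huv, huv.symm, hvw, hvw.symm, huw, huw.symm]
    by_cases k6 : a = u ∧ b = w
    · obtain ⟨rfl, rfl⟩ := k6; simp only [← d3, e3]
      simp [huv, huv.symm, hvw, hvw.symm, huw, huw.symm]
    simp only [k1, k2, k3, k4, k5, k6, if_false, add_zero]
    apply hcold a b ha hb <;> rw [Ne, Set.pair_eq_pair_iff, not_or]
    exacts [⟨k1, k2⟩, ⟨k3, k4⟩, ⟨k5, k6⟩]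
  have key : ∀ U : Finset V, U ⊆ G'.verts →
      cutCost G' U = min (cutCost G U) (cutCost G (insert x U)) := by
    intro U hU
    rw [hverts] at hU
    have hxU : x ∉ U := fun h => by simpa using hU h
    have s1 : G.verts \ U = insert x (G'.verts \ U) := by
      rw [hverts]; ext a; by_cases h : a = x
      · subst h; simp [hxU, hxm]
      · simp [h]
    have s2 : G.verts \ insert x U = G'.verts \ U := by
      rw [hverts]; ext a; simp; tauto
    have hxB : x ∉ G'.verts \ U := by simp [hverts]
    have c1 : cutCost G U = ∑ a ∈ U, ∑ b ∈ G'.verts \ U, G.c a b + ∑ a ∈ U, G.c a x := by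
      unfold cutCost
      rw [s1, ← Finset.sum_add_distrib]
      refine Finset.sum_congr rfl fun a _ => ?_
      rw [Finset.sum_insert hxB, add_comm]
    have c2 : cutCost G (insert x U) =
        ∑ a ∈ U, ∑ b ∈ G'.verts \ U, G.c a b + ∑ a ∈ G'.verts \ U, G.c a x := by
      unfold cutCost
      rw [s2, Finset.sum_insert hxU, add_comm]
      congr 1
      exact Finset.sum_congr rfl fun a _ => G.c_symm _ _
    have c3 : cutCost G' U = ∑ a ∈ U, ∑ b ∈ G'.verts \ U, (G.c a b
      + (if a = u ∧ b = v then G'.c u v else 0) + (if a = v ∧ b = u then G'.c u v else 0)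
      + (if a = v ∧ b = w then G'.c v w else 0) + (if a = w ∧ b = v then G'.c v w else 0)
      + (if a = w ∧ b = u then G'.c w u else 0) + (if a = u ∧ b = w then G'.c w u else 0)) := by
      unfold cutCost
      refine Finset.sum_congr rfl fun a ha => Finset.sum_congr rfl fun b hb => hc' a b ?_ ?_
      · rintro rfl; exact hxU ha
      · rintro rfl; exact hxB hb
    simp only [Finset.sum_add_distrib, sum_single_pair'] at c3
    rw [hsx] at c1 c2
    have m : ∀ a, a ∈ G.verts → x ≠ a → (a ∈ G'.verts \ U ↔ a ∉ U) := by
      intro a ha hxa; simp [hverts, ha, hxa.symm]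
    simp only [m u hum hxu, m v hvm hxv, m w hwm hxw, hcuv, hcvw, hcwu] at c1 c2 c3
    have n1 := G.c_nonneg u x
    have n2 := G.c_nonneg v x
    have n3 := G.c_nonneg w x
    rw [c1, c2, c3]
    generalize ∑ a ∈ U, ∑ b ∈ G'.verts \ U, G.c a b = T
    by_cases i1 : u ∈ U <;> by_cases i2 : v ∈ U <;> by_cases i3 : w ∈ U <;>
      simp only [i1, i2, i3, not_true, not_false_iff, and_true, and_false, if_true, if_false] <;>
      first
      | (rw [min_eq_left (by linarith)]; linarith)
      | (rw [min_eq_right (by linarith)]; linarith)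
  intro S hS
  have hKx : K ⊆ G'.verts := by
    intro a ha
    rw [hverts, Finset.mem_erase]
    exact ⟨fun h => hxK (h ▸ ha), hK ha⟩
  apply le_antisymm
  · refine le_csInf ⟨_, S, hS.trans hK, Finset.inter_eq_left.2 hS, rfl⟩ ?_
    rintro _ ⟨U, hU, hUK, rfl⟩
    have hU' : U.erase x ⊆ G'.verts := by rw [hverts]; exact Finset.erase_subset_erase x hU
    have hUK' : U.erase x ∩ K = S := by
      rw [← hUK]; ext a; simp only [Finset.mem_inter, Finset.mem_erase]
      exact ⟨fun h => ⟨h.1.2, h.2⟩, fun h => ⟨⟨fun e => hxK (e ▸ h.2), h.1⟩, h.2⟩⟩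
    refine (mincut_le' G' K S _ hU' hUK').trans ?_
    rw [key _ hU']
    by_cases hxU : x ∈ U
    · rw [Finset.insert_erase hxU]; exact min_le_right _ _
    · rw [Finset.erase_eq_of_notMem hxU]; exact min_le_left _ _
  · refine le_csInf ⟨_, S, hS.trans hKx, Finset.inter_eq_left.2 hS, rfl⟩ ?_
    rintro _ ⟨U, hU, hUK, rfl⟩
    rw [key _ hU]
    have hU' : U ⊆ G.verts := hU.trans (by rw [hverts]; exact Finset.erase_subset _ _)
    refine le_min (mincut_le' G K S _ hU' hUK) (mincut_le' G K S _ ?_ ?_)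
    · exact Finset.insert_subset hxm hU'
    · rw [Finset.insert_inter_of_notMem hxK, hUK]
end
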